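/- Let n ≥ 1 and let π ∈ S_n. If π avoids both the pattern 321 and the pattern 3412, then the fiber of the MVP outcome map over π satisfies |O_n^{-1}(π)| = ∏_{j=1}^{n} |Ω_j(π)|. -/

import Mathlib

open Finset

namespace MVPPark

/-- One step of the MVP parking process: car `c`, preferring spot `p`, arrives at the
state `state` (recording, for each spot, the car parked there, if any).  Car `c` always
parks in spot `p`; if spot `p` was occupied by an (earlier) car `j`, then `j` is bumped
and parks in the first unoccupied spot strictly beyond `p`, if such a spot exists
(otherwise `j` drives off unparked). -/
def mvpStep {n : ℕ} (state : Fin n → Option (Fin n)) (c p : Fin n) :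
    Fin n → Option (Fin n) :=
  match state p with
  | none => Function.update state p (some c)
  | some j =>
    match (List.finRange n).find? (fun k => decide (p < k) && (state k).isNone) with
    | none => Function.update state p (some c)
    | some k => Function.update (Function.update state p (some c)) k (some j)

/-- The final state of the MVP parking process with preference list `α`:
cars `0, 1, …, n-1` enter in order, car `i` preferring spot `α i`. -/
def mvpRun {n : ℕ} (α : Fin n → Fin n) : Fin n → Option (Fin n) :=
  (List.finRange n).foldl (fun st c => mvpStep st c (α c)) (fun _ => none)

/-- `α` is an MVP parking function: under the MVP rule, all `n` cars end up parked. -/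
def IsMVP {n : ℕ} (α : Fin n → Fin n) : Prop :=
  ∀ c : Fin n, ∃ j : Fin n, mvpRun α j = some c

/-- The outcome of the MVP parking process on `α` is the permutation `π`:
for each `j`, spot `j` ends up occupied by car `π j`. -/
def MvpOutcome {n : ℕ} (α : Fin n → Fin n) (π : Equiv.Perm (Fin n)) : Prop :=
  ∀ j : Fin n, mvpRun α j = some (π j)

end MVPPark

namespace MVPPark

/-- `C_j(π)`: the set of cars arriving after car `π j` that park to the left of
spot `j`, together with car `π j` itself. -/
def Cset {n : ℕ} (π : Equiv.Perm (Fin n)) (j : Fin n) : Finset (Fin n) :=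
  ((Finset.univ.filter (fun k => k < j)).image π ∩
      Finset.univ.filter (fun c => π j < c)) ∪ {π j}

/-- `Ω_j(π)`: the set of spots on or to the left of spot `j` occupied (in the outcome
`π`) by a car of `C_j(π)`. -/
def Omega {n : ℕ} (π : Equiv.Perm (Fin n)) (j : Fin n) : Finset (Fin n) :=
  Finset.univ.filter (fun k => k ≤ j ∧ π k ∈ Cset π j)

end MVPPark

namespace MVPPark

/-- `π` contains the pattern `321`. -/
def Contains321 {n : ℕ} (π : Equiv.Perm (Fin n)) : Prop :=
  ∃ x y z : Fin n, x < y ∧ y < z ∧ π z < π y ∧ π y < π x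

/-- `π` contains the pattern `3412`. -/
def Contains3412 {n : ℕ} (π : Equiv.Perm (Fin n)) : Prop :=
  ∃ w x y z : Fin n, w < x ∧ x < y ∧ y < z ∧ π y < π z ∧ π z < π w ∧ π w < π x

end MVPPark

namespace MVPPark

/-- The three possible effects of one parking step. -/
theorem mvpStep_cases {n : ℕ} (st : Fin n → Option (Fin n)) (c p : Fin n) :
    (st p = none ∧ mvpStep st c p = Function.update st p (some c)) ∨
    (∃ j, st p = some j ∧ (∀ q, p < q → st q ≠ none) ∧
      mvpStep st c p = Function.update st p (some c)) ∨
    (∃ j q, st p = some j ∧ p < q ∧ st q = none ∧ (∀ r, p < r → r < q → st r ≠ none) ∧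
      mvpStep st c p = Function.update (Function.update st p (some c)) q (some j)) := by
  unfold mvpStep
  rcases hp : st p with _ | j
  · simp
  · right
    rcases hf : (List.finRange n).find? (fun k => decide (p < k) && (st k).isNone) with _ | q
    · left
      rw [List.find?_eq_none] at hf
      refine ⟨j, rfl, fun q hq h => hf q (List.mem_finRange q) ?_, by simp⟩
      simp [hq, h]
    · right
      have hq := List.find?_some hf
      simp only [Bool.and_eq_true, decide_eq_true_eq, Option.isNone_iff_eq_none] at hq
      refine ⟨j, q, rfl, hq.1, hq.2, fun r hpr hrq hr => ?_, by simp⟩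
      rw [List.find?_eq_some_iff_getElem] at hf
      obtain ⟨-, i, hi, hiq, hlt⟩ := hf
      have hri : (r : ℕ) < i := by
        have : (q : ℕ) = i := by rw [← hiq]; simp
        have := Fin.lt_def.1 hrq
        omega
      have := hlt r hri
      simp [hpr, hr] at this

/-- An invariant preserved by every parking step holds for the final state. -/
theorem mvpRun_induction {n : ℕ} (α : Fin n → Fin n)
    (P : ℕ → (Fin n → Option (Fin n)) → Prop) (h0 : P 0 fun _ => none)
    (hstep : ∀ (c : Fin n) st, P c st → P (c + 1) (mvpStep st c (α c))) :
    P n (mvpRun α) := by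
  have key : ∀ m ≤ n, P m (((List.finRange n).take m).foldl
      (fun st c => mvpStep st c (α c)) (fun _ => none)) := by
    intro m
    induction m with
    | zero => intro _; simpa using h0
    | succ m ih =>
      intro hm
      have hl : m < (List.finRange n).length := by simp; omega
      rw [List.take_succ_eq_append_getElem hl, List.foldl_append]
      simpa using hstep ⟨m, hm⟩ _ (ih (by omega))
  have := key n le_rfl
  rwa [List.take_of_length_le (by simp)] at this

theorem mem_Omega {n : ℕ} {π : Equiv.Perm (Fin n)} {j k : Fin n} :
    k ∈ Omega π j ↔ k ≤ j ∧ π j ≤ π k := by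
  simp only [Omega, Cset, mem_filter, mem_univ, true_and, mem_union, mem_inter, mem_image,
    EmbeddingLike.apply_eq_iff_eq, exists_eq_right, mem_singleton]
  constructor
  · rintro ⟨h, ⟨-, h'⟩ | rfl⟩
    · exact ⟨h, h'.le⟩
    · exact ⟨le_rfl, le_rfl⟩
  · rintro ⟨h, h'⟩
    refine ⟨h, ?_⟩
    rcases h.lt_or_eq with h | h
    · exact Or.inl ⟨h, lt_of_le_of_ne h' fun e => h.ne' (π.injective e)⟩
    · exact Or.inr h

/-- The preference of car `π j` always lies in `Ω_j(π)`. -/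
theorem MvpOutcome.mem_Omega {n : ℕ} {α : Fin n → Fin n} {π : Equiv.Perm (Fin n)}
    (h : MvpOutcome α π) (j : Fin n) : α (π j) ∈ Omega π j := by
  have key := mvpRun_induction α
    (fun m st => (∀ p x, st p = some x → (x : ℕ) < m) ∧ ((π j : ℕ) < m →
      (∀ p, st p = some (π j) → α (π j) ≤ p) ∧ ∃ x, st (α (π j)) = some x ∧ π j ≤ x))
    (by simp) ?_
  · obtain ⟨-, key⟩ := key
    obtain ⟨h1, x, hx, hle⟩ := key (π j).2
    rw [h] at hx
    obtain rfl := Option.some.inj hx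
    exact MVPPark.mem_Omega.2 ⟨h1 j (h j), hle⟩
  · rintro c st ⟨hlt, hQ⟩
    generalize π j = i at *
    have hi : i = c ∨ ((i : ℕ) < c ∧ i ≠ c) ∨ (c : ℕ) < i := by
      rcases lt_trichotomy i c with h | h | h
      · exact Or.inr (Or.inl ⟨h, h.ne⟩)
      · exact Or.inl h
      · exact Or.inr (Or.inr h)
    rcases mvpStep_cases st c (α c) with ⟨hn, he⟩ | ⟨y, hy, -, he⟩ | ⟨y, q, hy, hpq, hq, -, he⟩ <;>
      rw [he] <;> clear he <;> simp only [Function.update_apply] <;> grind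

/-- If every car prefers a spot of its `Ω`-set and `π` avoids `321` and `3412`, then the
outcome is `π`. -/
theorem mvpOutcome_of_mem_Omega {n : ℕ} {α : Fin n → Fin n} {π : Equiv.Perm (Fin n)}
    (h321 : ¬ Contains321 π) (h3412 : ¬ Contains3412 π)
    (h : ∀ j, α (π j) ∈ Omega π j) : MvpOutcome α π := by
  have no321 : ∀ x y z, x < y → y < z → π z < π y → ¬ π y < π x :=
    fun x y z a b c d => h321 ⟨x, y, z, a, b, c, d⟩
  have no3412 : ∀ w x y z, w < x → x < y → y < z → π y < π z → π z < π w → ¬ π w < π x :=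
    fun w x y z a b c d e f => h3412 ⟨w, x, y, z, a, b, c, d, e, f⟩
  have no_cycle : ∀ w x y z, w ≠ x → w < y → x < y → y < z →
      π z < π w → π z < π x → π y < π w → ¬ π y < π x := by
    intro w x y z hne hw hx hyz h1 h2 h3 h4
    have hyz' : π y < π z := by
      by_contra! hle
      exact no321 w y z hw hyz (lt_of_le_of_ne hle fun e => hyz.ne' (π.injective e)) h3
    have hπ : π w ≠ π x := fun e => hne (π.injective e)
    rcases lt_or_gt_of_ne hne with hlt | hlt <;> rcases lt_or_gt_of_ne hπ with hlt' | hlt'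
    · exact no3412 w x y z hlt hx hyz hyz' h1 hlt'
    · exact no321 w x y hlt hx h4 hlt'
    · exact no321 x w y hlt hw h3 hlt'
    · exact no3412 x w y z hlt hw hyz hyz' h2 hlt'
  have key := mvpRun_induction α
    (fun m st =>
      (∀ p j, st p = some (π j) → (π j : ℕ) < m ∧ p ≤ j ∧ (p = j ∨ m ≤ (π p : ℕ))) ∧
      (∀ j, (π j : ℕ) < m → ∃ p, st p = some (π j)) ∧
      (∀ p p' j, st p = some (π j) → st p' = some (π j) → p = p'))
    (by simp) ?_
  · obtain ⟨h1, h2, -⟩ := key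
    intro j
    obtain ⟨p, hp⟩ := h2 j (π j).2
    rcases (h1 p j hp).2.2 with rfl | h'
    · exact hp
    · exact absurd (π p).2 (by omega)
  · rintro c st ⟨hpos, hex, huniq⟩
    obtain ⟨m, rfl⟩ := π.surjective c
    obtain ⟨hkm, hπk⟩ := mem_Omega.1 (h m)
    generalize α (π m) = k at *
    have hnone : ∀ p, st p ≠ some (π m) := fun p hp => by
      have := (hpos p m hp).1
      omega
    have hinj : ∀ a b, (π a : ℕ) = π b → a = b := fun a b e => π.injective (Fin.ext e)
    have hstay : ∀ p j, st p = some (π j) → p ≠ k → p = j ∨ (π m : ℕ) + 1 ≤ π p := by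
      intro p j hp hpk
      obtain ⟨hj, hpj, rfl | hle⟩ := hpos p j hp
      · exact Or.inl rfl
      · by_contra! hcon
        obtain rfl : p = m := hinj _ _ (by omega)
        exact no321 k p j (lt_of_le_of_ne hkm (Ne.symm hpk)) (lt_of_le_of_ne hpj hcon.1)
          hj (lt_of_le_of_ne hπk fun e => hpk (π.injective e))
    have hkm' : k = m ∨ (π m : ℕ) + 1 ≤ π k := by
      by_cases e : k = m
      · exact Or.inl e
      · have : (π m : ℕ) ≠ π k := fun e' => e (hinj _ _ e').symm
        have := Fin.le_def.1 hπk
        omega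
    rcases mvpStep_cases st (π m) k with ⟨hn, he⟩ | hoc
    · rw [he]
      simp only [Function.update_apply]
      refine ⟨?_, ?_, ?_⟩
      · grind
      · intro j hj
        by_cases hjm : j = m
        · exact ⟨k, by simp [hjm]⟩
        · obtain ⟨p, hp⟩ := hex j (by have := mt (hinj j m) hjm; omega)
          exact ⟨p, by grind⟩
      · grind
    · have hbump : ∀ j, st k = some (π j) → k < j ∧ (π j : ℕ) < π m ∧ st j = none := by
        intro j hj
        obtain ⟨hlt, hkj, hor⟩ := hpos k j hj
        have hkj' : k < j := lt_of_le_of_ne hkj (by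
          rintro rfl
          have := Fin.le_def.1 hπk
          omega)
        refine ⟨hkj', hlt, ?_⟩
        by_contra hne
        obtain ⟨y, hy⟩ := Option.ne_none_iff_exists'.1 hne
        obtain ⟨x, rfl⟩ := π.surjective y
        rcases (hpos j x hy).2.2 with rfl | hle
        · exact hkj'.ne (huniq _ _ _ hj hy)
        · omega
      rcases hoc with ⟨y, hy, hfull, -⟩ | ⟨y, q, hy, hkq, hq, hfirst, he⟩
      · obtain ⟨j, rfl⟩ := π.surjective y
        obtain ⟨hkj, -, hj⟩ := hbump j hy
        exact absurd hj (hfull j hkj)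
      · obtain ⟨j, rfl⟩ := π.surjective y
        obtain ⟨hkj, hjm, hj⟩ := hbump j hy
        have hqj : q ≤ j := by
          by_contra! hlt
          exact hfirst j hkj hlt hj
        have hqπ : q = j ∨ (π m : ℕ) + 1 ≤ π q := by
          by_contra! hcon
          have hqj' := lt_of_le_of_ne hqj hcon.1
          have hk : k ≠ m → π m < π k := fun hne =>
            lt_of_le_of_ne hπk fun e => hne (π.injective e).symm
          rcases (Nat.lt_succ_iff.1 hcon.2).lt_or_eq with hlt | heq
          · obtain ⟨p, hp⟩ := hex q hlt
            have hpq : p ≠ q := by rintro rfl; simp [hq] at hp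
            have hpk : p ≠ k := by
              rintro rfl
              exact hcon.1 (π.injective (Option.some.inj (hp.symm.trans hy)))
            obtain ⟨-, hle, rfl | hle'⟩ := hpos p q hp
            · exact hpq rfl
            · have hjm' : π j < π m := hjm
              have hqm : π q < π m := hlt
              have hpm : π m ≤ π p := hle'
              exact no_cycle p k q j hpk (lt_of_le_of_ne hle hpq) hkq hqj'
                (hjm'.trans_le hpm) (hjm'.trans_le hπk) (hqm.trans_le hpm) (hqm.trans_le hπk)
          · obtain rfl := hinj _ _ heq
            exact no321 k q j hkq hqj' hjm (hk hkq.ne)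
        have hjm_ne : j ≠ m := by rintro rfl; omega
        rw [he]
        simp only [Function.update_apply]
        refine ⟨?_, ?_, ?_⟩
        · grind
        · intro i hi
          by_cases him : i = m
          · exact ⟨k, by simp [him, hkq.ne]⟩
          · by_cases hij : i = j
            · exact ⟨q, by simp [hij]⟩
            · obtain ⟨p, hp⟩ := hex i (by have := mt (hinj i m) him; omega)
              have hpi : π j ≠ π i := fun e => hij (π.injective e).symm
              exact ⟨p, by grind⟩
        · have hπjm : π j ≠ π m := fun e => hjm_ne (π.injective e)
          have hj_only : ∀ p, st p = some (π j) → p = k := fun p hp => huniq p k j hp hy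
          have hπ : ∀ a b, π a = π b → a = b := fun a b e => π.injective e
          clear no321 no3412 no_cycle hpos hex hstay hbump hfirst h
          intro p p' i hp hp'
          have hi := huniq p p' i
          split_ifs at hp hp' <;> grind

end MVPPark

open MVPPark in
/-- If `π` avoids both the pattern `321` and the pattern `3412`, then the fiber of the
MVP outcome map over `π` has cardinality `∏_j |Ω_j(π)|`. -/
theorem fiber_eq_of_avoids (n : ℕ) (hn : 1 ≤ n) (π : Equiv.Perm (Fin n))
    (h321 : ¬ Contains321 π) (h3412 : ¬ Contains3412 π) :
    Nat.card {α : Fin n → Fin n // MvpOutcome α π} = ∏ j : Fin n, (Omega π j).card := by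
  have hiff : ∀ α : Fin n → Fin n, MvpOutcome α π ↔
      α ∈ Fintype.piFinset fun i => Omega π (π.symm i) := by
    intro α
    rw [Fintype.mem_piFinset]
    refine ⟨fun h i => by simpa using h.mem_Omega (π.symm i), fun h => ?_⟩
    exact mvpOutcome_of_mem_Omega h321 h3412 fun j => by simpa using h (π j)
  rw [Nat.card_congr (Equiv.subtypeEquivRight hiff), Nat.card_eq_fintype_card,
    Fintype.card_coe, Fintype.card_piFinset]
  exact Equiv.prod_comp π.symm fun j => (Omega π j).card
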